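/- Two distinct U-trees T and T' satisfy |T ∩ T'| = a + b (i.e. they differ in a single element) if and only if T' is a rotation of T or T is a rotation of T'. -/

import Mathlib

/-- A sequence `u 0, …, u a` of positive integers is unimodular if it increases
up to some index `k ≤ a` and decreases afterwards. -/
def IsUnimodular (a : ℕ) (u : ℕ → ℕ) : Prop :=
  (∀ i, i ≤ a → 0 < u i) ∧
  ∃ k, k ≤ a ∧ (∀ i j, i ≤ j → j ≤ k → u i ≤ u j) ∧
    (∀ i j, k ≤ i → i ≤ j → j ≤ a → u j ≤ u i)

/-- The stack set of the sequence `u 0, …, u a`: the point in column `i` and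
row `j` (rows increasing downward) belongs to it iff `i ≤ a` and `j < u i`. -/
def stackSet (a : ℕ) (u : ℕ → ℕ) : Set (ℕ × ℕ) :=
  {p | p.1 ≤ a ∧ p.2 < u p.1}

/-- Two points `p, q` are `U`-incompatible if one is strictly southwest or strictly
northeast of the other and the whole rectangle spanned by them lies inside `U`. -/
def Incompat (U : Set (ℕ × ℕ)) (p q : ℕ × ℕ) : Prop :=
  ((p.1 < q.1 ∧ q.2 < p.2) ∨ (q.1 < p.1 ∧ p.2 < q.2)) ∧
  ∀ k l : ℕ, min p.1 q.1 ≤ k → k ≤ max p.1 q.1 → min p.2 q.2 ≤ l → l ≤ max p.2 q.2 →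
    (k, l) ∈ U

/-- `U`-compatibility. -/
def Compat (U : Set (ℕ × ℕ)) (p q : ℕ × ℕ) : Prop := ¬ Incompat U p q

/-- A `U`-tree is a maximal (under inclusion) pairwise `U`-compatible subset of `U`. -/
def IsUTree (U T : Set (ℕ × ℕ)) : Prop :=
  T ⊆ U ∧ T.Pairwise (Compat U) ∧
    ∀ T' : Set (ℕ × ℕ), T' ⊆ U → T'.Pairwise (Compat U) → T ⊆ T' → T' = T

/-- The set of lattice points of the smallest rectangle containing `p` and `r`. -/
def rect (p r : ℕ × ℕ) : Set (ℕ × ℕ) :=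
  {x | min p.1 r.1 ≤ x.1 ∧ x.1 ≤ max p.1 r.1 ∧ min p.2 r.2 ≤ x.2 ∧ x.2 ≤ max p.2 r.2}

/-- The lower-left corner `p ⌞ r` (minimal column, maximal row) of the rectangle
spanned by `p` and `r`. -/
def llcorner (p r : ℕ × ℕ) : ℕ × ℕ := (min p.1 r.1, max p.2 r.2)

/-- The upper-right corner `p ⌝ r` (maximal column, minimal row) of the rectangle
spanned by `p` and `r`. -/
def urcorner (p r : ℕ × ℕ) : ℕ × ℕ := (max p.1 r.1, min p.2 r.2)

/-- `T'` is obtained from `T` by a rotation: there are `p, q, r ∈ T` with `p, r` in distinct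
rows and distinct columns, `q = p⌞r`, no element of `T` other than `p, q, r` lies in `p□r`,
and `T' = (T \ {q}) ∪ {p⌝r}`. -/
def IsRotation (T T' : Set (ℕ × ℕ)) : Prop :=
  ∃ p q r : ℕ × ℕ, p ∈ T ∧ q ∈ T ∧ r ∈ T ∧ p.1 ≠ r.1 ∧ p.2 ≠ r.2 ∧
    q = llcorner p r ∧ (∀ x ∈ T, x ∈ rect p r → x = p ∨ x = q ∨ x = r) ∧
    T' = (T \ {q}) ∪ {urcorner p r}

section StackSet

variable {a : ℕ} {u : ℕ → ℕ} {T T' : Set (ℕ × ℕ)}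

theorem stackSet_of_row_le {i j l : ℕ} (h : (i, j) ∈ stackSet a u) (hl : l ≤ j) :
    (i, l) ∈ stackSet a u :=
  ⟨h.1, lt_of_le_of_lt hl h.2⟩

theorem IsUnimodular.stackSet_row_convex (hu : IsUnimodular a u) {i j k m : ℕ}
    (hi : (i, j) ∈ stackSet a u) (hk : (k, j) ∈ stackSet a u) (him : i ≤ m) (hmk : m ≤ k) :
    (m, j) ∈ stackSet a u := by
  obtain ⟨-, c, -, hinc, hdec⟩ := hu
  have hka : k ≤ a := hk.1
  refine ⟨hmk.trans hka, ?_⟩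
  rcases le_total m c with h | h
  · exact lt_of_lt_of_le hi.2 (hinc i m him h)
  · exact lt_of_lt_of_le hk.2 (hdec m k h hmk hka)

theorem Incompat.symm {U : Set (ℕ × ℕ)} {p q : ℕ × ℕ} (h : Incompat U p q) :
    Incompat U q p := by
  refine ⟨h.1.symm, fun k l h₁ h₂ h₃ h₄ => h.2 k l ?_ ?_ ?_ ?_⟩ <;> omega

/-- Incompatibility in a stack set only depends on the lower-right corner of the rectangle. -/
theorem IsUnimodular.incompat_of_corner (hu : IsUnimodular a u) {p q : ℕ × ℕ}
    (hp : p ∈ stackSet a u) (h₁ : p.1 < q.1) (h₂ : q.2 < p.2)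
    (hc : (q.1, p.2) ∈ stackSet a u) : Incompat (stackSet a u) p q := by
  refine ⟨Or.inl ⟨h₁, h₂⟩, fun k l hk hk' hl hl' => ?_⟩
  have hk₁ : p.1 ≤ k := by omega
  have hk₂ : k ≤ q.1 := by omega
  have hl₁ : l ≤ p.2 := by omega
  exact stackSet_of_row_le (hu.stackSet_row_convex hp hc hk₁ hk₂) hl₁

theorem Incompat.corner_mem {U : Set (ℕ × ℕ)} {p q : ℕ × ℕ} (h : Incompat U p q) :
    (p.1 < q.1 ∧ q.2 < p.2 ∧ (q.1, p.2) ∈ U) ∨ (q.1 < p.1 ∧ p.2 < q.2 ∧ (p.1, q.2) ∈ U) := by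
  obtain ⟨h | h, hr⟩ := h
  · exact Or.inl ⟨h.1, h.2, hr _ _ (by omega) (by omega) (by omega) (by omega)⟩
  · exact Or.inr ⟨h.1, h.2, hr _ _ (by omega) (by omega) (by omega) (by omega)⟩

theorem IsUTree.corner_notMem (hu : IsUnimodular a u) (hT : IsUTree (stackSet a u) T)
    {p q : ℕ × ℕ} (hp : p ∈ T) (hq : q ∈ T) (h₁ : p.1 < q.1) (h₂ : q.2 < p.2) :
    (q.1, p.2) ∉ stackSet a u := by
  intro hc
  have hpq : p ≠ q := by rintro rfl; omega
  exact hT.2.1 hp hq hpq (hu.incompat_of_corner (hT.1 hp) h₁ h₂ hc)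

theorem IsUTree.exists_incompat {U : Set (ℕ × ℕ)} (hT : IsUTree U T) {x : ℕ × ℕ} (hx : x ∈ U)
    (hxT : x ∉ T) : ∃ y ∈ T, Incompat U x y := by
  by_contra! hcon
  have h := hT.2.2 (insert x T) (Set.insert_subset hx hT.1)
    (hT.2.1.insert fun y hy _ => ⟨hcon y hy, fun h => hcon y hy h.symm⟩) (Set.subset_insert x T)
  exact hxT (h ▸ Set.mem_insert x T)

/-- A point outside a `U`-tree has an obstruction southwest or northeast of it. -/
theorem IsUTree.exists_obstruction {U : Set (ℕ × ℕ)} (hT : IsUTree U T) {x : ℕ × ℕ} (hx : x ∈ U)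
    (hxT : x ∉ T) : (∃ y ∈ T, y.1 < x.1 ∧ x.2 < y.2 ∧ (x.1, y.2) ∈ U) ∨
      ∃ y ∈ T, x.1 < y.1 ∧ y.2 < x.2 ∧ (y.1, x.2) ∈ U := by
  obtain ⟨y, hy, h⟩ := hT.exists_incompat hx hxT
  rcases h.corner_mem with h | h
  · exact Or.inr ⟨y, hy, h⟩
  · exact Or.inl ⟨y, hy, h⟩

theorem IsUTree.finite (hT : IsUTree (stackSet a u) T) {b : ℕ} (hub : ∀ i, i ≤ a → u i ≤ b + 1) :
    T.Finite := by
  refine ((Set.finite_Iic a).prod (Set.finite_Iio (b + 1))).subset fun x hx => ?_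
  exact ⟨(hT.1 hx).1, lt_of_lt_of_le (hT.1 hx).2 (hub _ (hT.1 hx).1)⟩

theorem IsUTree.root_mem (hu : IsUnimodular a u) (hT : IsUTree (stackSet a u) T) :
    ((0, 0) : ℕ × ℕ) ∈ T := by
  by_contra h
  rcases hT.exists_obstruction ⟨Nat.zero_le a, hu.1 0 (Nat.zero_le a)⟩ h with
    ⟨y, -, h', -⟩ | ⟨y, -, -, h', -⟩ <;> simp at h'

theorem IsUTree.exists_mem_column (hu : IsUnimodular a u) (hT : IsUTree (stackSet a u) T)
    (hfin : T.Finite) {i : ℕ} (hi : i ≤ a) : ∃ x ∈ T, x.1 = i := by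
  by_contra! hcon
  rcases hT.exists_obstruction (x := (i, 0)) ⟨hi, hu.1 i hi⟩ (fun h => hcon _ h rfl) with
    hy | ⟨y, -, -, h', -⟩
  · obtain ⟨z, ⟨hz, hz₁, hz₂⟩, hzmax⟩ := Set.exists_max_image
      {y ∈ T | y.1 < i ∧ (i, y.2) ∈ stackSet a u} Prod.snd (hfin.subset fun _ h => h.1)
      (hy.imp fun y h => ⟨h.1, h.2.1, h.2.2.2⟩)
    rcases hT.exists_obstruction hz₂ (fun h => hcon _ h rfl) with
      ⟨w, hw, h₁, h₂, h₃⟩ | ⟨w, hw, h₁, h₂, h₃⟩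
    · exact absurd (hzmax w ⟨hw, h₁, h₃⟩) (not_le.2 h₂)
    · exact hT.corner_notMem hu hz hw (hz₁.trans h₁) h₂ h₃
  · simp at h'

theorem IsUTree.exists_mem_row (hu : IsUnimodular a u) (hT : IsUTree (stackSet a u) T)
    (hfin : T.Finite) {j : ℕ} (hj : ∃ i, (i, j) ∈ stackSet a u) : ∃ x ∈ T, x.2 = j := by
  classical
  by_contra! hcon
  have hs := Nat.find_spec hj
  have hy : ∃ y ∈ T, y.2 < j ∧ (y.1, j) ∈ stackSet a u := by
    rcases hT.exists_obstruction hs (fun h => hcon _ h rfl) with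
      ⟨y, hy, h₁, h₂, -⟩ | ⟨y, hy, -, h₂, h₃⟩
    · exact absurd (stackSet_of_row_le (hT.1 hy) h₂.le) (Nat.find_min hj h₁)
    · exact ⟨y, hy, h₂, h₃⟩
  obtain ⟨z, ⟨hz, hz₁, hz₂⟩, hzmax⟩ := Set.exists_max_image
    {y ∈ T | y.2 < j ∧ (y.1, j) ∈ stackSet a u} Prod.fst (hfin.subset fun _ h => h.1) hy
  rcases hT.exists_obstruction hz₂ (fun h => hcon _ h rfl) with
    ⟨w, hw, h₁, h₂, h₃⟩ | ⟨w, hw, h₁, h₂, h₃⟩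
  · exact hT.corner_notMem hu hw hz h₁ (hz₁.trans h₂) h₃
  · exact absurd (hzmax w ⟨hw, h₂, h₃⟩) (not_le.2 h₁)

/-- Every node other than the root has a node to its left in its row or above it in its column. -/
theorem IsUTree.exists_parent (hu : IsUnimodular a u) (hT : IsUTree (stackSet a u) T)
    (hfin : T.Finite) {p : ℕ × ℕ} (hp : p ∈ T) (hp0 : p ≠ (0, 0)) :
    (∃ x ∈ T, x.2 = p.2 ∧ x.1 < p.1) ∨ ∃ x ∈ T, x.1 = p.1 ∧ x.2 < p.2 := by
  by_contra! hcon
  obtain ⟨hrow, hcol⟩ := hcon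
  rcases Nat.eq_zero_or_pos p.2 with hj | hj
  · have h := hrow _ (hT.root_mem hu) hj.symm
    exact hp0 (Prod.ext (Nat.le_zero.1 h) hj)
  have hlt : ∀ y ∈ T, y.1 < p.1 → (p.1, y.2) ∈ stackSet a u → y.2 < p.2 := by
    intro y hy h₁ h₂
    rcases lt_trichotomy y.2 p.2 with h | h | h
    · exact h
    · exact absurd (hrow y hy h) (not_le.2 h₁)
    · exact absurd h₂ (hT.corner_notMem hu hy hp h₁ h)
  rcases hT.exists_obstruction (x := (p.1, 0)) (stackSet_of_row_le (hT.1 hp) hj.le)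
    (fun h => absurd (hcol _ h rfl) (not_le.2 hj)) with hy | ⟨y, -, -, h', -⟩
  · obtain ⟨z, ⟨hz, hz₁, hz₂⟩, hzmax⟩ := Set.exists_max_image
      {y ∈ T | y.1 < p.1 ∧ (p.1, y.2) ∈ stackSet a u} Prod.snd (hfin.subset fun _ h => h.1)
      (hy.imp fun y h => ⟨h.1, h.2.1, h.2.2.2⟩)
    rcases hT.exists_obstruction hz₂
      (fun h => absurd (hcol _ h rfl) (not_le.2 (hlt z hz hz₁ hz₂))) with
      ⟨w, hw, h₁, h₂, h₃⟩ | ⟨w, hw, h₁, h₂, h₃⟩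
    · exact absurd (hzmax w ⟨hw, h₁, h₃⟩) (not_le.2 h₂)
    · exact hT.corner_notMem hu hz hw (hz₁.trans h₁) h₂ h₃
  · simp at h'

theorem IsUTree.ncard_eq {b : ℕ} (hu : IsUnimodular a u) (hub : ∀ i, i ≤ a → u i ≤ b + 1)
    (hmax : ∃ i, i ≤ a ∧ u i = b + 1) (hT : IsUTree (stackSet a u) T) :
    T.ncard = a + b + 1 := by
  have hfin := hT.finite hub
  set A : Set (ℕ × ℕ) := {p ∈ T | ∀ x ∈ T, x.2 = p.2 → p.1 ≤ x.1} with hA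
  set B : Set (ℕ × ℕ) := {p ∈ T | ∀ x ∈ T, x.1 = p.1 → p.2 ≤ x.2} with hB
  have hAfin : A.Finite := hfin.subset fun _ h => h.1
  have hBfin : B.Finite := hfin.subset fun _ h => h.1
  have hAcard : A.ncard = b + 1 := by
    have hinj : Set.InjOn Prod.snd A := fun p hp q hq h =>
      Prod.ext (le_antisymm (hp.2 q hq.1 h.symm) (hq.2 p hp.1 h)) h
    have himg : Prod.snd '' A = Set.Iio (b + 1) := by
      ext j
      constructor
      · rintro ⟨p, hp, rfl⟩
        exact lt_of_lt_of_le (hT.1 hp.1).2 (hub _ (hT.1 hp.1).1)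
      · intro hj
        obtain ⟨i, hi, hui⟩ := hmax
        obtain ⟨z, ⟨hz, hzj⟩, hzmin⟩ := Set.exists_min_image {x ∈ T | x.2 = j} Prod.fst
          (hfin.subset fun _ h => h.1)
          (hT.exists_mem_row hu hfin ⟨i, hi, hui.symm ▸ hj⟩)
        exact ⟨z, ⟨hz, fun x hx h => hzmin x ⟨hx, h.trans hzj⟩⟩, hzj⟩
    rw [← hinj.ncard_image, himg, Set.ncard_eq_toFinset_card']
    simp
  have hBcard : B.ncard = a + 1 := by
    have hinj : Set.InjOn Prod.fst B := fun p hp q hq h =>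
      Prod.ext h (le_antisymm (hp.2 q hq.1 h.symm) (hq.2 p hp.1 h))
    have himg : Prod.fst '' B = Set.Iio (a + 1) := by
      ext i
      constructor
      · rintro ⟨p, hp, rfl⟩
        exact Nat.lt_succ_of_le (hT.1 hp.1).1
      · intro hi
        obtain ⟨z, ⟨hz, hzi⟩, hzmin⟩ := Set.exists_min_image {x ∈ T | x.1 = i} Prod.snd
          (hfin.subset fun _ h => h.1)
          (hT.exists_mem_column hu hfin (Nat.le_of_lt_succ hi))
        exact ⟨z, ⟨hz, fun x hx h => hzmin x ⟨hx, h.trans hzi⟩⟩, hzi⟩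
    rw [← hinj.ncard_image, himg, Set.ncard_eq_toFinset_card']
    simp
  have hunion : A ∪ B = T := by
    refine Set.Subset.antisymm (Set.union_subset (fun _ h => h.1) fun _ h => h.1) fun p hp => ?_
    by_contra hcon
    simp only [hA, hB, Set.mem_union, Set.mem_ofPred_eq, hp, true_and, not_or] at hcon
    push Not at hcon
    obtain ⟨⟨x, hx, hx₁, hx₂⟩, y, hy, hy₁, hy₂⟩ := hcon
    refine hT.corner_notMem hu hx hy (hy₁ ▸ hx₂) (hx₁ ▸ hy₂) ?_
    rw [hx₁, hy₁]
    exact hT.1 hp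
  have hinter : A ∩ B = {(0, 0)} := by
    ext p
    constructor
    · rintro ⟨hpA, hpB⟩
      by_contra hp0
      rcases hT.exists_parent hu hfin hpA.1 hp0 with ⟨x, hx, h₁, h₂⟩ | ⟨x, hx, h₁, h₂⟩
      · exact absurd (hpA.2 x hx h₁) (not_le.2 h₂)
      · exact absurd (hpB.2 x hx h₁) (not_le.2 h₂)
    · rintro rfl
      exact ⟨⟨hT.root_mem hu, fun _ _ _ => Nat.zero_le _⟩,
        ⟨hT.root_mem hu, fun _ _ _ => Nat.zero_le _⟩⟩
  have h := Set.ncard_union_add_ncard_inter A B hAfin hBfin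
  rw [hunion, hinter, Set.ncard_singleton] at h
  omega

theorem IsUTree.isRotation_of_exchange (hu : IsUnimodular a u) (hT : IsUTree (stackSet a u) T)
    (hT' : IsUTree (stackSet a u) T') {q q' : ℕ × ℕ} (hq : q ∈ T) (hq' : q' ∈ T')
    (hTT' : T' = (T \ {q}) ∪ {q'}) (h₁ : q.1 < q'.1) (h₂ : q'.2 < q.2)
    (hc : (q'.1, q.2) ∈ stackSet a u) : IsRotation T T' := by
  have hmem : ∀ y ∈ T, y ≠ q → y ∈ T' := fun y hy hyq => hTT' ▸ Or.inl ⟨hy, hyq⟩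
  have hp : (q.1, q'.2) ∈ T := by
    by_contra hcon
    rcases hT.exists_obstruction (stackSet_of_row_le (hT.1 hq) h₂.le) hcon with
      ⟨y, hy, h₃, h₄, h₅⟩ | ⟨y, hy, h₃, h₄, h₅⟩
    · dsimp only at h₃ h₄ h₅
      have hy' := hmem y hy (by rintro rfl; omega)
      rcases lt_or_ge q.2 y.2 with h | h
      · exact hT.corner_notMem hu hy hq h₃ h h₅
      · exact hT'.corner_notMem hu hy' hq' (h₃.trans h₁) h₄ (stackSet_of_row_le hc h)
    · dsimp only at h₃ h₄ h₅
      have hy' := hmem y hy (by rintro rfl; omega)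
      rcases lt_or_ge q'.1 y.1 with h | h
      · exact hT'.corner_notMem hu hq' hy' h h₄ h₅
      · exact hT.corner_notMem hu hq hy h₃ (h₄.trans h₂)
          (hu.stackSet_row_convex (hT.1 hq) hc h₃.le h)
  have hr : (q'.1, q.2) ∈ T := by
    by_contra hcon
    rcases hT.exists_obstruction hc hcon with ⟨y, hy, h₃, h₄, h₅⟩ | ⟨y, hy, h₃, h₄, h₅⟩
    · dsimp only at h₃ h₄ h₅
      have hy' := hmem y hy (by rintro rfl; omega)
      exact hT'.corner_notMem hu hy' hq' h₃ (h₂.trans h₄) h₅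
    · exact hT.corner_notMem hu hq hy (h₁.trans h₃) h₄ h₅
  refine ⟨(q.1, q'.2), q, (q'.1, q.2), hp, hq, hr, h₁.ne, h₂.ne, ?_, ?_, ?_⟩
  · ext <;> simp only [llcorner] <;> omega
  · rintro ⟨k, l⟩ hx ⟨hx₁, hx₂, hx₃, hx₄⟩
    dsimp only at hx₁ hx₂ hx₃ hx₄
    by_cases hxq : (k, l) = q
    · exact Or.inr (Or.inl hxq)
    have hqx : ¬ (q.1 < k ∧ l < q.2) := fun h => hT.corner_notMem hu hq hx h.1 h.2
      (hu.stackSet_row_convex (hT.1 hq) hc h.1.le (by omega))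
    have hq'x : ¬ (k < q'.1 ∧ q'.2 < l) := fun h => hT'.corner_notMem hu (hmem _ hx hxq) hq' h.1 h.2
      (stackSet_of_row_le hc (show l ≤ q.2 by omega))
    have hor : (k = q.1 ∧ l = q'.2) ∨ (k = q'.1 ∧ l = q.2) ∨ (k = q.1 ∧ l = q.2) := by omega
    rcases hor with ⟨rfl, rfl⟩ | ⟨rfl, rfl⟩ | ⟨rfl, rfl⟩
    · exact Or.inl rfl
    · exact Or.inr (Or.inr rfl)
    · exact Or.inr (Or.inl rfl)
  · have hur : urcorner (q.1, q'.2) (q'.1, q.2) = q' := by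
      ext <;> simp only [urcorner] <;> omega
    rw [hur]
    exact hTT'

theorem IsRotation.ncard_inter {n : ℕ} (h : IsRotation T T') (hfin : T.Finite) (hfin' : T'.Finite)
    (hn : T.ncard = n + 1) (hn' : T'.ncard = n + 1) (hne : T ≠ T') :
    (T ∩ T').ncard = n := by
  obtain ⟨p, q, r, -, hq, -, -, -, -, -, hTT'⟩ := h
  have hsub : T \ {q} ⊆ T ∩ T' := fun x hx => ⟨hx.1, hTT' ▸ Or.inl hx⟩
  have hle := Set.ncard_le_ncard hsub (hfin.inter_of_left T')
  rw [Set.ncard_sdiff_singleton_of_mem hq, hn] at hle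
  have hlt : (T ∩ T').ncard < T.ncard := by
    refine Set.ncard_lt_ncard (Set.inter_subset_left.ssubset_of_ne fun hcon => hne ?_) hfin
    exact Set.eq_of_subset_of_ncard_le (Set.inter_eq_left.1 hcon) (by omega) hfin'
  omega

theorem exists_exchange {α : Type*} {S S' : Set α} {n : ℕ} (hfin : S.Finite) (hfin' : S'.Finite)
    (hn : S.ncard = n + 1) (hn' : S'.ncard = n + 1) (h : (S ∩ S').ncard = n) :
    ∃ x x', x ∈ S ∧ x' ∈ S' ∧ x' ∉ S ∧ S' = (S \ {x}) ∪ {x'} ∧ S = (S' \ {x'}) ∪ {x} := by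
  have hd := Set.ncard_inter_add_ncard_sdiff_eq_ncard S S' hfin
  have hd' := Set.ncard_inter_add_ncard_sdiff_eq_ncard S' S hfin'
  rw [Set.inter_comm] at hd'
  obtain ⟨x, hx⟩ := Set.ncard_eq_one.1 (show (S \ S').ncard = 1 by omega)
  obtain ⟨x', hx'⟩ := Set.ncard_eq_one.1 (show (S' \ S).ncard = 1 by omega)
  have hxm : ∀ y, (y ∈ S ∧ y ∉ S') ↔ y = x := fun y => Set.ext_iff.1 hx y
  have hxm' : ∀ y, (y ∈ S' ∧ y ∉ S) ↔ y = x' := fun y => Set.ext_iff.1 hx' y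
  refine ⟨x, x', ((hxm x).2 rfl).1, ((hxm' x').2 rfl).1, ((hxm' x').2 rfl).2, ?_, ?_⟩
  · ext y
    have := hxm y
    have := hxm' y
    simp only [Set.mem_union, Set.mem_sdiff, Set.mem_singleton_iff]
    tauto
  · ext y
    have := hxm y
    have := hxm' y
    simp only [Set.mem_union, Set.mem_sdiff, Set.mem_singleton_iff]
    tauto

end StackSet

/-- Two distinct `U`-trees `T`, `T'` satisfy `|T ∩ T'| = a + b`
(i.e. they differ in a single element) if and only if `T'` is a rotation of `T`
or `T` is a rotation of `T'`. -/
theorem utree_flip_iff_rotation (a b : ℕ) (u : ℕ → ℕ) (hu : IsUnimodular a u)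
    (hub : ∀ i, i ≤ a → u i ≤ b + 1) (hmax : ∃ i, i ≤ a ∧ u i = b + 1)
    (T T' : Set (ℕ × ℕ)) (hT : IsUTree (stackSet a u) T) (hT' : IsUTree (stackSet a u) T')
    (hne : T ≠ T') :
    (T ∩ T').ncard = a + b ↔ IsRotation T T' ∨ IsRotation T' T := by
  have hfin := hT.finite hub
  have hfin' := hT'.finite hub
  have hcard := hT.ncard_eq hu hub hmax
  have hcard' := hT'.ncard_eq hu hub hmax
  constructor
  · intro h
    obtain ⟨q, q', hq, hq', hq'T, hex, hex'⟩ := exists_exchange hfin hfin' hcard hcard' h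
    obtain ⟨y, hy, hinc⟩ := hT.exists_incompat (hT'.1 hq') hq'T
    obtain rfl : y = q := by
      by_contra hyq
      have hyT' : y ∈ T' := hex ▸ Or.inl ⟨hy, hyq⟩
      exact hT'.2.1 hq' hyT' (fun h => hq'T (h ▸ hy)) hinc
    rcases hinc.corner_mem with ⟨h₁, h₂, h₃⟩ | ⟨h₁, h₂, h₃⟩
    · exact Or.inr (hT'.isRotation_of_exchange hu hT hq' hq hex' h₁ h₂ h₃)
    · exact Or.inl (hT.isRotation_of_exchange hu hT' hq hq' hex h₁ h₂ h₃)
  · rintro (h | h)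
    · exact h.ncard_inter hfin hfin' hcard hcard' hne
    · rw [Set.inter_comm]
      exact h.ncard_inter hfin' hfin hcard' hcard hne.symm
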